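/- For every integer n ≥ 3, the number of knot (3,n)-mosaics satisfies D_{3,n} = (2/5)(9·6^{n-2} + 1); equivalently, 5·D_{3,n} = 2(9·6^{n-2} + 1). -/

import Mathlib

/-- The eleven mosaic tiles `T₀, …, T₁₀`. -/
inductive Tile : Type
  | T0 | T1 | T2 | T3 | T4 | T5 | T6 | T7 | T8 | T9 | T10
  deriving DecidableEq

namespace Tile

/-- Whether the top edge of a tile carries a connection point.
`T0` has no connection points; `T1,…,T6` realize the six unordered pairs of edges
(`T1`: bottom–left, `T2`: bottom–right, `T3`: top–right, `T4`: top–left,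
`T5`: left–right, `T6`: top–bottom); `T7,…,T10` have all four. -/
def top : Tile → Bool
  | .T3 | .T4 | .T6 | .T7 | .T8 | .T9 | .T10 => true
  | _ => false

/-- Whether the bottom edge of a tile carries a connection point. -/
def bottom : Tile → Bool
  | .T1 | .T2 | .T6 | .T7 | .T8 | .T9 | .T10 => true
  | _ => false

/-- Whether the left edge of a tile carries a connection point. -/
def left : Tile → Bool
  | .T1 | .T4 | .T5 | .T7 | .T8 | .T9 | .T10 => true
  | _ => false

/-- Whether the right edge of a tile carries a connection point. -/
def right : Tile → Bool
  | .T2 | .T3 | .T5 | .T7 | .T8 | .T9 | .T10 => true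
  | _ => false

end Tile

/-- An `(m,n)`-mosaic `M : Fin m → Fin n → Tile` (rows indexed top-to-bottom,
columns left-to-right) is suitably connected if any pair of contiguous tiles
have or do not have connection points simultaneously on their common edge. -/
def SuitablyConnected {m n : ℕ} (M : Fin m → Fin n → Tile) : Prop :=
  (∀ (i : Fin m) (j : Fin n) (h : (j : ℕ) + 1 < n),
    (M i j).right = (M i ⟨(j : ℕ) + 1, h⟩).left) ∧
  (∀ (i : Fin m) (j : Fin n) (h : (i : ℕ) + 1 < m),
    (M i j).bottom = (M ⟨(i : ℕ) + 1, h⟩ j).top)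

/-- None of the boundary edges of the mosaic carries a connection point. -/
def BoundaryFree {m n : ℕ} (M : Fin m → Fin n → Tile) : Prop :=
  ∀ (i : Fin m) (j : Fin n),
    ((i : ℕ) = 0 → (M i j).top = false) ∧
    ((i : ℕ) = m - 1 → (M i j).bottom = false) ∧
    ((j : ℕ) = 0 → (M i j).left = false) ∧
    ((j : ℕ) = n - 1 → (M i j).right = false)

/-- A knot `(m,n)`-mosaic is a suitably connected mosaic none of whose boundary
edges has a connection point. -/
def IsKnotMosaic {m n : ℕ} (M : Fin m → Fin n → Tile) : Prop :=
  SuitablyConnected M ∧ BoundaryFree M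

/-- `D m n`, the number of knot `(m,n)`-mosaics. -/
noncomputable def knotMosaicCount (m n : ℕ) : ℕ :=
  Nat.card {M : Fin m → Fin n → Tile // IsKnotMosaic M}

/-- `|Q^{(p,q)}|`, the number of `(p,q)`-quasimosaics (suitably connected
`(p,q)`-mosaics, with connection points allowed on boundary edges). -/
noncomputable def quasimosaicCount (p q : ℕ) : ℕ :=
  Nat.card {M : Fin p → Fin q → Tile // SuitablyConnected M}

instance : Fintype Tile where
  elems := {.T0, .T1, .T2, .T3, .T4, .T5, .T6, .T7, .T8, .T9, .T10}
  complete t := by cases t <;> decide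

/-- A column of `m` tiles is closed if it is suitably connected vertically and has no connection
point on its top and bottom boundary edges. -/
def IsClosedColumn {m : ℕ} (c : Fin m → Tile) : Prop :=
  (∀ (i : Fin m) (h : (i : ℕ) + 1 < m), (c i).bottom = (c ⟨(i : ℕ) + 1, h⟩).top) ∧
    ∀ i : Fin m, ((i : ℕ) = 0 → (c i).top = false) ∧ ((i : ℕ) = m - 1 → (c i).bottom = false)

instance {m : ℕ} (c : Fin m → Tile) : Decidable (IsClosedColumn c) :=
  inferInstanceAs (Decidable (_ ∧ _))

/-- The connection pattern on the left side of a column. -/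
def leftState {m : ℕ} (c : Fin m → Tile) : Fin m → Bool := fun i => (c i).left

/-- The connection pattern on the right side of a column. -/
def rightState {m : ℕ} (c : Fin m → Tile) : Fin m → Bool := fun i => (c i).right

/-- A sequence of closed columns, each connected to the next, with pattern `s` on the left side
and no connection point on the right side. -/
def IsColumnPath {m : ℕ} : (n : ℕ) → (Fin m → Bool) → (Fin n → Fin m → Tile) → Prop
  | 0, s, _ => s = fun _ => false
  | n + 1, s, C => (IsClosedColumn (C 0) ∧ leftState (C 0) = s) ∧
      IsColumnPath n (rightState (C 0)) (Fin.tail C)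

/-- The number of column paths with pattern `s` on the left side. -/
noncomputable def columnPathCount {m : ℕ} (n : ℕ) (s : Fin m → Bool) : ℕ :=
  Nat.card {C : Fin n → Fin m → Tile // IsColumnPath n s C}

/-- The number of closed columns with given patterns on the left and right sides. -/
def columnCount {m : ℕ} (s r : Fin m → Bool) : ℕ :=
  (Finset.univ.filter fun c : Fin m → Tile =>
    (IsClosedColumn c ∧ leftState c = s) ∧ rightState c = r).card

lemma isColumnPath_succ_iff {m : ℕ} (n : ℕ) (s : Fin m → Bool) (C : Fin (n + 1) → Fin m → Tile) :
    IsColumnPath (n + 1) s C ↔ (∀ j, IsClosedColumn (C j)) ∧ leftState (C 0) = s ∧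
      (∀ j : Fin n, rightState (C j.castSucc) = leftState (C j.succ)) ∧
      rightState (C (Fin.last n)) = fun _ => false := by
  induction n generalizing s with
  | zero => simp [IsColumnPath, and_assoc]
  | succ n ih =>
    rw [IsColumnPath, ih, Fin.forall_fin_succ (P := fun j => IsClosedColumn (C j)),
      Fin.forall_fin_succ (P := fun j => rightState (C j.castSucc) = leftState (C j.succ))]
    simp only [Fin.tail, Fin.succ_last, Fin.castSucc_zero, Fin.succ_castSucc]
    grind

lemma isKnotMosaic_iff {m n : ℕ} (M : Fin m → Fin (n + 1) → Tile) :
    IsKnotMosaic M ↔ IsColumnPath (n + 1) (fun _ => false) (fun j i => M i j) := by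
  rw [isColumnPath_succ_iff]
  simp only [funext_iff, leftState, rightState]
  constructor
  · rintro ⟨⟨hr, hb⟩, hf⟩
    exact ⟨fun j => ⟨fun i h => hb i j h, fun i => ⟨(hf i j).1, (hf i j).2.1⟩⟩,
      fun i => (hf i 0).2.2.1 rfl, fun j i => hr i j.castSucc (by simp),
      fun i => (hf i (Fin.last n)).2.2.2 (by simp)⟩
  · rintro ⟨hc, hl, hr, he⟩
    refine ⟨⟨fun i j h => hr ⟨j, by omega⟩ i, fun i j h => (hc j).1 i h⟩,
      fun i j => ⟨((hc j).2 i).1, ((hc j).2 i).2, fun h => ?_, fun h => ?_⟩⟩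
    · obtain rfl : j = 0 := Fin.ext h
      exact hl i
    · obtain rfl : j = Fin.last n := Fin.ext h
      exact he i

lemma knotMosaicCount_succ (m n : ℕ) :
    knotMosaicCount m (n + 1) = columnPathCount (m := m) (n + 1) fun _ => false :=
  Nat.card_congr ((Equiv.piComm fun _ _ => Tile).subtypeEquiv isKnotMosaic_iff)

lemma columnPathCount_zero {m : ℕ} (s : Fin m → Bool) :
    columnPathCount 0 s = if s = fun _ => false then 1 else 0 := by
  simp only [columnPathCount, IsColumnPath]
  split_ifs with h <;> simp [h]

/-- A nonempty column path is a closed column followed by a column path. -/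
def columnPathSuccEquiv {m : ℕ} (n : ℕ) (s : Fin m → Bool) :
    {C : Fin (n + 1) → Fin m → Tile // IsColumnPath (n + 1) s C} ≃
      Σ c : {c : Fin m → Tile // IsClosedColumn c ∧ leftState c = s},
        {C : Fin n → Fin m → Tile // IsColumnPath n (rightState c.1) C} where
  toFun C := ⟨⟨C.1 0, C.2.1⟩, ⟨Fin.tail C.1, C.2.2⟩⟩
  invFun p := ⟨Fin.cons p.1.1 p.2.1, p.1.2, p.2.2⟩
  left_inv C := Subtype.ext (Fin.cons_self_tail C.1)
  right_inv _ := rfl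

lemma columnPathCount_succ {m : ℕ} (n : ℕ) (s : Fin m → Bool) :
    columnPathCount (n + 1) s = ∑ r, columnCount s r * columnPathCount n r := by
  rw [columnPathCount, Nat.card_congr (columnPathSuccEquiv n s), Nat.card_sigma]
  change ∑ c : {c : Fin m → Tile // IsClosedColumn c ∧ leftState c = s},
    columnPathCount n (rightState c.1) = _
  rw [← Finset.sum_subtype (Finset.univ.filter fun c => IsClosedColumn c ∧ leftState c = s)
      (by simp) (fun c => columnPathCount n (rightState c)),
    ← Finset.sum_fiberwise _ rightState]
  refine Finset.sum_congr rfl fun r _ => ?_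
  rw [columnCount, ← smul_eq_mul, ← Finset.sum_const, Finset.filter_filter]
  exact Finset.sum_congr rfl fun c hc => by rw [(Finset.mem_filter.1 hc).2.2]

lemma columnCount_three :
    ∀ s ∈ ({![false, false, false], ![true, true, false], ![true, false, true],
      ![false, true, true]} : Finset (Fin 3 → Bool)), ∀ r, columnCount s r =
        if (r 0 ^^ r 1 ^^ r 2) then 0
        else if s 1 && r 1 && (s 0 ^^ r 0) then 4 else 1 := by
  decide +kernel

lemma columnPathCount_three_succ (n : ℕ) (s : Fin 3 → Bool)
    (hs : s ∈ ({![false, false, false], ![true, true, false], ![true, false, true],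
      ![false, true, true]} : Finset (Fin 3 → Bool))) :
    columnPathCount (n + 1) s =
      columnPathCount n ![false, false, false] +
      (if s 1 && !s 0 then 4 else 1) * columnPathCount n ![true, true, false] +
      columnPathCount n ![true, false, true] +
      (if s 1 && s 0 then 4 else 1) * columnPathCount n ![false, true, true] := by
  have huniv : (Finset.univ : Finset (Fin 3 → Bool)) =
      {![false, false, false], ![true, true, false], ![true, false, true], ![false, true, true],
        ![true, false, false], ![false, true, false], ![false, false, true],
        ![true, true, true]} := by decide
  rw [columnPathCount_succ, Finset.sum_congr rfl fun r _ => by rw [columnCount_three s hs r],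
    huniv]
  simp [add_assoc]

lemma columnPathCount_three (n : ℕ) :
    10 * columnPathCount (n + 1) ![false, false, false] = 6 ^ (n + 1) + 4 ∧
    5 * columnPathCount (n + 1) ![true, true, false] + 1 = 6 ^ (n + 1) ∧
    10 * columnPathCount (n + 1) ![true, false, true] = 6 ^ (n + 1) + 4 ∧
    5 * columnPathCount (n + 1) ![false, true, true] + 1 = 6 ^ (n + 1) := by
  have h₀ := columnPathCount_three_succ (s := ![false, false, false]) (hs := by simp)
  have h₁ := columnPathCount_three_succ (s := ![true, true, false]) (hs := by simp)
  have h₂ := columnPathCount_three_succ (s := ![true, false, true]) (hs := by simp)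
  have h₃ := columnPathCount_three_succ (s := ![false, true, true]) (hs := by simp)
  simp only [Matrix.cons_val_zero, Matrix.cons_val_one, Bool.and_true, Bool.and_false,
    Bool.not_true, Bool.not_false, Bool.false_eq_true, if_true, if_false, one_mul] at h₀ h₁ h₂ h₃
  induction n with
  | zero =>
    rw [h₀, h₁, h₂, h₃]
    simp only [columnPathCount_zero]
    decide
  | succ n ih =>
    rw [h₀ (n + 1), h₁ (n + 1), h₂ (n + 1), h₃ (n + 1), pow_succ]
    omega

/-- For every integer `n ≥ 3`, `D_{3,n} = (2/5)(9·6^{n-2} + 1)`, stated in the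
equivalent integer form `5·D_{3,n} = 2(9·6^{n-2} + 1)`. -/
theorem knotMosaicCount_three (n : ℕ) (hn : 3 ≤ n) :
    5 * knotMosaicCount 3 n = 2 * (9 * 6 ^ (n - 2) + 1) := by
  obtain ⟨k, rfl⟩ := Nat.exists_eq_add_of_le' hn
  have h := (columnPathCount_three (k + 2)).1
  have hzero : (![false, false, false] : Fin 3 → Bool) = fun _ => false := by decide
  rw [hzero, ← knotMosaicCount_succ 3] at h
  rw [show k + 3 - 2 = k + 1 by omega, pow_succ]
  rw [show k + 2 + 1 = k + 3 from rfl, pow_add] at h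
  omega
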